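/- arXiv:math/0312450 — 2 statements merged into one kernel-verified Lean document; each statement's English description precedes it below -/
import Mathlib

section
/- Let K be a graph of bounded valence, Δ the combinatorial Laplacian and Δ_σ the discrete magnetic Laplacian for a multiplier σ. For every λ > 0 and every f ∈ C⁰₍₂₎(K), one has the pointwise resolvent domination |(Δ_σ + λI)^{-1} f| ≤ (Δ + λI)^{-1} |f|. -/
open ComplexConjugate

/-- The combinatorial Laplacian on complex-valued functions. -/
noncomputable def combLapC {V : Type*} (G : SimpleGraph V) [G.LocallyFinite]
    (f : V → ℂ) (v : V) : ℂ :=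
  ∑ w ∈ G.neighborFinset v, (f v - f w)

/-- The discrete magnetic Laplacian associated to a multiplier `σ`. -/
noncomputable def magLap {V : Type*} (G : SimpleGraph V) [G.LocallyFinite]
    (σ : V → V → ℂ) (f : V → ℂ) (v : V) : ℂ :=
  ∑ w ∈ G.neighborFinset v, (f v - σ w v * f w)

/-- Weighted Cauchy–Schwarz inequality for a finite family together with one extra point
of weight `m - #s`. -/
lemma sq_weighted_sum_le {ι : Type*} (s : Finset ι) (F : ι → ℝ) (a m : ℝ)
    (hm : (s.card : ℝ) ≤ m) :
    ((m - s.card) * a + ∑ i ∈ s, F i) ^ 2 ≤ m * ((m - s.card) * a ^ 2 + ∑ i ∈ s, F i ^ 2) := by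
  have h1 : (∑ i ∈ s, F i) ^ 2 ≤ s.card * ∑ i ∈ s, F i ^ 2 := sq_sum_le_card_mul_sum_sq
  have h2 : 0 ≤ s.card * a ^ 2 - 2 * a * ∑ i ∈ s, F i + ∑ i ∈ s, F i ^ 2 := by
    have h : 0 ≤ ∑ i ∈ s, (a - F i) ^ 2 := Finset.sum_nonneg fun i _ => sq_nonneg _
    simpa [sub_sq, Finset.sum_add_distrib, Finset.sum_sub_distrib, Finset.mul_sum] using h
  nlinarith [mul_nonneg (sub_nonneg.2 hm) h2]

/-- Double counting: sums of a nonnegative function over the neighbourhoods of finitely many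
vertices are controlled by a degree-weighted sum. -/
lemma sum_sum_neighborFinset_le {V : Type*} [DecidableEq V] (G : SimpleGraph V)
    [G.LocallyFinite] (F : V → ℝ) (hF : ∀ v, 0 ≤ F v) (s : Finset V) :
    ∑ v ∈ s, ∑ w ∈ G.neighborFinset v, F w ≤
      ∑ w ∈ s ∪ s.biUnion (fun v => G.neighborFinset v), (G.degree w : ℝ) * F w := by
  have hswap : ∑ v ∈ s, ∑ w ∈ G.neighborFinset v, F w =
      ∑ w ∈ s ∪ s.biUnion (fun v => G.neighborFinset v),
        ∑ _v ∈ s ∩ G.neighborFinset w, F w := by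
    refine Finset.sum_comm' fun v w => ?_
    simp only [Finset.mem_inter, Finset.mem_union, Finset.mem_biUnion,
      SimpleGraph.mem_neighborFinset]
    exact ⟨fun h => ⟨⟨h.1, h.2.symm⟩, Or.inr ⟨v, h⟩⟩, fun h => ⟨h.1.1, h.1.2.symm⟩⟩
  rw [hswap]
  refine Finset.sum_le_sum fun w _ => ?_
  rw [Finset.sum_const, nsmul_eq_mul, ← G.card_neighborFinset_eq_degree]
  exact mul_le_mul_of_nonneg_right
    (by exact_mod_cast Finset.card_le_card Finset.inter_subset_right) (hF w)

lemma norm_smul_one_sub_magLap_le {V : Type*} [DecidableEq V] (G : SimpleGraph V)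
    [G.LocallyFinite] (M : ℕ) (hM : ∀ v, G.degree v ≤ M)
    (σ : V → V → ℂ) (hσ1 : ∀ u v, G.Adj u v → ‖σ u v‖ = 1)
    (B : lp (fun _ : V => ℂ) 2 →L[ℂ] lp (fun _ : V => ℂ) 2)
    (hB : ∀ (f : lp (fun _ : V => ℂ) 2) (v : V), B f v = magLap G σ (⇑f) v) :
    ‖(M : ℂ) • (1 : lp (fun _ : V => ℂ) 2 →L[ℂ] lp (fun _ : V => ℂ) 2) - B‖ ≤ M := by
  refine ContinuousLinearMap.opNorm_le_bound _ (Nat.cast_nonneg M) fun x => ?_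
  have hpt : ∀ v, ‖(((M : ℂ) • (1 : lp (fun _ : V => ℂ) 2 →L[ℂ] lp (fun _ : V => ℂ) 2) - B) x) v‖ ^ 2
      ≤ M * ((M - G.degree v) * ‖x v‖ ^ 2 + ∑ w ∈ G.neighborFinset v, ‖x w‖ ^ 2) := by
    intro v
    have hd : (G.degree v : ℝ) ≤ M := by exact_mod_cast hM v
    have heq : (((M : ℂ) • (1 : lp (fun _ : V => ℂ) 2 →L[ℂ] lp (fun _ : V => ℂ) 2) - B) x) v
        = ((M - G.degree v : ℝ) : ℂ) * x v + ∑ w ∈ G.neighborFinset v, σ w v * x w := by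
      change (M : ℂ) * x v - B x v = _
      rw [hB, magLap, Finset.sum_sub_distrib, Finset.sum_const, nsmul_eq_mul,
        G.card_neighborFinset_eq_degree]
      push_cast
      ring
    have hle : ‖(((M : ℂ) • (1 : lp (fun _ : V => ℂ) 2 →L[ℂ] lp (fun _ : V => ℂ) 2) - B) x) v‖
        ≤ (M - G.degree v) * ‖x v‖ + ∑ w ∈ G.neighborFinset v, ‖x w‖ := by
      rw [heq]
      refine (norm_add_le _ _).trans (add_le_add ?_ ((norm_sum_le _ _).trans ?_))
      · rw [norm_mul, Complex.norm_real, Real.norm_of_nonneg (sub_nonneg.2 hd)]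
      · refine Finset.sum_le_sum fun w hw => ?_
        rw [norm_mul, hσ1 w v ((G.mem_neighborFinset v w).1 hw).symm, one_mul]
    refine (pow_le_pow_left₀ (norm_nonneg _) hle 2).trans ?_
    have := sq_weighted_sum_le (G.neighborFinset v) (fun w => ‖x w‖) ‖x v‖ M
      (by rwa [G.card_neighborFinset_eq_degree])
    rwa [G.card_neighborFinset_eq_degree] at this
  refine lp.norm_le_of_forall_sum_le (by norm_num) (by positivity) fun s => ?_
  simp only [ENNReal.toReal_ofNat, Real.rpow_ofNat]
  set t := s ∪ s.biUnion (fun v => G.neighborFinset v)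
  have hx : ∑ w ∈ t, ‖x w‖ ^ 2 ≤ ‖x‖ ^ 2 := by
    simpa using lp.sum_rpow_le_norm_rpow (p := 2) (by norm_num) x t
  have h1 : ∑ v ∈ s, ((M : ℝ) - G.degree v) * ‖x v‖ ^ 2 ≤
      ∑ v ∈ t, ((M : ℝ) - G.degree v) * ‖x v‖ ^ 2 :=
    Finset.sum_le_sum_of_subset_of_nonneg Finset.subset_union_left fun v _ _ =>
      mul_nonneg (sub_nonneg.2 (by exact_mod_cast hM v)) (by positivity)
  have h2 := sum_sum_neighborFinset_le G (fun w => ‖x w‖ ^ 2) (fun w => by positivity) s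
  have h3 : ∑ v ∈ t, ((M : ℝ) - G.degree v) * ‖x v‖ ^ 2 +
      ∑ w ∈ t, (G.degree w : ℝ) * ‖x w‖ ^ 2 = M * ∑ w ∈ t, ‖x w‖ ^ 2 := by
    rw [← Finset.sum_add_distrib, Finset.mul_sum]
    exact Finset.sum_congr rfl fun w _ => by ring
  refine (Finset.sum_le_sum fun v _ => hpt v).trans ?_
  rw [← Finset.mul_sum, Finset.sum_add_distrib, mul_pow, pow_two (M : ℝ), mul_assoc]
  refine mul_le_mul_of_nonneg_left ?_ (Nat.cast_nonneg M)
  nlinarith [mul_le_mul_of_nonneg_left hx (Nat.cast_nonneg (α := ℝ) M)]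

lemma isUnit_magLap_add_smul_one {V : Type*} [DecidableEq V] (G : SimpleGraph V)
    [G.LocallyFinite] (M : ℕ) (hM : ∀ v, G.degree v ≤ M)
    (σ : V → V → ℂ) (hσ1 : ∀ u v, G.Adj u v → ‖σ u v‖ = 1)
    (B : lp (fun _ : V => ℂ) 2 →L[ℂ] lp (fun _ : V => ℂ) 2)
    (hB : ∀ (f : lp (fun _ : V => ℂ) 2) (v : V), B f v = magLap G σ (⇑f) v)
    (lam : ℝ) (hlam : 0 < lam) : IsUnit (B + (lam : ℂ) • 1) := by
  have hT := norm_smul_one_sub_magLap_le G M hM σ hσ1 B hB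
  have hone : ‖(1 : lp (fun _ : V => ℂ) 2 →L[ℂ] lp (fun _ : V => ℂ) 2)‖ ≤ 1 :=
    ContinuousLinearMap.norm_id_le
  have hk : ‖((M + lam : ℝ) : ℂ)‖ = M + lam := by
    rw [Complex.norm_real, Real.norm_of_nonneg (by positivity)]
  have hmem := spectrum.mem_resolventSet_of_norm_lt_mul (𝕜 := ℂ) (k := ((M + lam : ℝ) : ℂ))
    (a := (M : ℂ) • (1 : lp (fun _ : V => ℂ) 2 →L[ℂ] lp (fun _ : V => ℂ) 2) - B) (by
      rw [hk]
      nlinarith [mul_le_mul hT hone (norm_nonneg _) (Nat.cast_nonneg M)])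
  rw [spectrum.mem_resolventSet_iff, Algebra.algebraMap_eq_smul_one] at hmem
  convert hmem using 1
  push_cast
  rw [add_smul]
  abel

/-- Maximum principle: a subsolution of `Δ + λ` that vanishes at infinity is nonpositive. -/
lemma nonpos_of_laplacian_add_le {V : Type*} (G : SimpleGraph V)
    [G.LocallyFinite] (lam : ℝ) (hlam : 0 < lam) (h : V → ℝ)
    (h0 : Filter.Tendsto h Filter.cofinite (nhds 0))
    (hsub : ∀ v, ∑ w ∈ G.neighborFinset v, (h v - h w) + lam * h v ≤ 0) (v : V) : h v ≤ 0 := by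
  by_contra! hv
  have hfin : {w | h v ≤ h w}.Finite := by
    simpa using Filter.eventually_cofinite.1 (h0.eventually (gt_mem_nhds hv))
  obtain ⟨m, hm, hmax⟩ := hfin.exists_maximalFor h _ ⟨v, le_refl (h v)⟩
  have hm' : h v ≤ h m := hm
  have hge : ∀ w, h w ≤ h m := fun w => by
    by_contra! hw
    exact absurd (hmax (hm'.trans hw.le : h v ≤ h w) hw.le) (not_le.2 hw)
  have hsum : 0 ≤ ∑ w ∈ G.neighborFinset m, (h m - h w) :=
    Finset.sum_nonneg fun w _ => sub_nonneg.2 (hge w)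
  nlinarith [hsub m, mul_pos hlam (hv.trans_le hm')]

lemma lp_two_tendsto_norm_cofinite {V : Type*} (x : lp (fun _ : V => ℂ) 2) :
    Filter.Tendsto (fun v => ‖x v‖) Filter.cofinite (nhds 0) := by
  have hs : Summable fun v => ‖x v‖ ^ 2 := by
    simpa using (lp.memℓp x).summable (by norm_num)
  simpa [Function.comp_def, Real.sqrt_sq] using
    (Real.continuous_sqrt.tendsto 0).comp hs.tendsto_cofinite_zero

/-- Pointwise resolvent domination: for `λ > 0`,
`|(Δ_σ + λ I)⁻¹ f| ≤ (Δ + λ I)⁻¹ |f|` pointwise. Here `A` and `Aσ` are the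
combinatorial and magnetic Laplacians as bounded operators on `ℓ²(K)`, and
`g = |f|` is the pointwise modulus of `f` as an element of `ℓ²(K)`. -/
theorem resolvent_domination {V : Type*} [DecidableEq V] (G : SimpleGraph V)
    [G.LocallyFinite] (M : ℕ) (hM : ∀ v, G.degree v ≤ M)
    (σ : V → V → ℂ) (hσ1 : ∀ u v, G.Adj u v → ‖σ u v‖ = 1)
    (hσ2 : ∀ u v, G.Adj u v → σ u v = conj (σ v u))
    (A Aσ : lp (fun _ : V => ℂ) 2 →L[ℂ] lp (fun _ : V => ℂ) 2)
    (hA : ∀ (f : lp (fun _ : V => ℂ) 2) (v : V), A f v = combLapC G (⇑f) v)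
    (hAσ : ∀ (f : lp (fun _ : V => ℂ) 2) (v : V), Aσ f v = magLap G σ (⇑f) v)
    (lam : ℝ) (hlam : 0 < lam)
    (f g : lp (fun _ : V => ℂ) 2) (hg : ∀ v, g v = (‖f v‖ : ℂ)) :
    ∀ v, ‖(Ring.inverse (Aσ + (lam : ℂ) • 1)) f v‖ ≤
      ((Ring.inverse (A + (lam : ℂ) • 1)) g v).re := by
  have hUσ := isUnit_magLap_add_smul_one G M hM σ hσ1 Aσ hAσ lam hlam
  have hU := isUnit_magLap_add_smul_one G M hM (fun _ _ => 1) (fun _ _ _ => norm_one) A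
    (fun f v => by simpa [magLap, combLapC] using hA f v) lam hlam
  set u := Ring.inverse (Aσ + (lam : ℂ) • 1) f with hu
  set w := Ring.inverse (A + (lam : ℂ) • 1) g with hw
  have hfu : (Aσ + (lam : ℂ) • 1) u = f := by
    rw [hu, ← mul_apply_eq_comp, Ring.mul_inverse_cancel _ hUσ,
      one_apply_eq_self]
  have hgw : (A + (lam : ℂ) • 1) w = g := by
    rw [hw, ← mul_apply_eq_comp, Ring.mul_inverse_cancel _ hU,
      one_apply_eq_self]
  have hfv : ∀ v, magLap G σ u v + lam * u v = f v := fun v => by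
    rw [← hAσ, ← hfu]; rfl
  have hgv : ∀ v, combLapC G w v + lam * w v = (‖f v‖ : ℂ) := fun v => by
    rw [← hA, ← hg, ← hgw]; rfl
  have hlim : Filter.Tendsto (fun v => ‖u v‖ - (w v).re) Filter.cofinite (nhds 0) := by
    have hre : Filter.Tendsto (fun v => (w v).re) Filter.cofinite (nhds 0) :=
      squeeze_zero_norm (fun v => Complex.abs_re_le_norm (w v)) (lp_two_tendsto_norm_cofinite w)
    simpa using (lp_two_tendsto_norm_cofinite u).sub hre
  intro v
  refine sub_nonpos.1 (nonpos_of_laplacian_add_le G lam hlam _ hlim (fun v => ?_) v)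
  have hgre : ∑ x ∈ G.neighborFinset v, ((w v).re - (w x).re) + lam * (w v).re = ‖f v‖ := by
    simpa [combLapC, -Finset.sum_sub_distrib] using congrArg Complex.re (hgv v)
  have hkato : ∑ x ∈ G.neighborFinset v, (‖u v‖ - ‖u x‖) + lam * ‖u v‖ ≤ ‖f v‖ := by
    have heq : (((G.degree v : ℝ) + lam : ℝ) : ℂ) * u v
        = f v + ∑ x ∈ G.neighborFinset v, σ x v * u x := by
      rw [← hfv v, magLap, Finset.sum_sub_distrib, Finset.sum_const, nsmul_eq_mul,
        G.card_neighborFinset_eq_degree]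
      push_cast
      ring
    have hn : ((G.degree v : ℝ) + lam) * ‖u v‖ ≤ ‖f v‖ + ∑ x ∈ G.neighborFinset v, ‖u x‖ := by
      have hnorm := congrArg norm heq
      rw [norm_mul, Complex.norm_real, Real.norm_of_nonneg (by positivity)] at hnorm
      rw [hnorm]
      refine (norm_add_le _ _).trans (add_le_add_right ((norm_sum_le _ _).trans ?_) _)
      refine Finset.sum_le_sum fun x hx => ?_
      rw [norm_mul, hσ1 x v ((G.mem_neighborFinset v x).1 hx).symm, one_mul]
    rw [Finset.sum_sub_distrib, Finset.sum_const, nsmul_eq_mul, G.card_neighborFinset_eq_degree]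
    linarith
  have hsplit : ∑ x ∈ G.neighborFinset v, ((‖u v‖ - (w v).re) - (‖u x‖ - (w x).re)) =
      ∑ x ∈ G.neighborFinset v, (‖u v‖ - ‖u x‖) -
        ∑ x ∈ G.neighborFinset v, ((w v).re - (w x).re) := by
    rw [← Finset.sum_sub_distrib]
    exact Finset.sum_congr rfl fun x _ => by ring
  rw [hsplit]
  linarith
end

section
/- Let K be an infinite connected graph of bounded valence, L the renormalized Laplacian Lu(x) = Σ_{y∼x}(φ(y)/φ(x))(u(x)−u(y)) associated to a positive ground state φ with Δφ = λ₀φ. Given a bounded initial value u₀ with |u₀(x)| ≤ N₀ for all x, the initial value problem Lu + ∂u/∂t = 0, u(x,0) = u₀(x) has a unique bounded solution u(x,t) on K × [0,∞), and this solution satisfies |u(x,t)| ≤ N₀ for all x and t. -/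
/-- The combinatorial Laplacian on real-valued functions. -/
noncomputable def combLap {V : Type*} (G : SimpleGraph V) [G.LocallyFinite]
    (f : V → ℝ) (v : V) : ℝ :=
  ∑ w ∈ G.neighborFinset v, (f v - f w)

/-- The renormalized Laplacian `L u (x) = ∑_{y ∼ x} (φ(y)/φ(x)) (u(x) - u(y))`. -/
noncomputable def renormLap {V : Type*} (G : SimpleGraph V) [G.LocallyFinite]
    (φ : V → ℝ) (u : V → ℝ) (x : V) : ℝ :=
  ∑ y ∈ G.neighborFinset x, (φ y / φ x) * (u x - u y)

section RenormalizedHeat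

variable {V : Type*} {G : SimpleGraph V} [G.LocallyFinite] {φ : V → ℝ} {lam0 : ℝ} {M : ℕ}

lemma renormLap_sub (u v : V → ℝ) (x : V) :
    renormLap G φ (fun y => u y - v y) x = renormLap G φ u x - renormLap G φ v x := by
  simp only [renormLap, ← Finset.sum_sub_distrib]
  exact Finset.sum_congr rfl fun y _ => by ring

lemma renormLap_add (u v : V → ℝ) (x : V) :
    renormLap G φ (fun y => u y + v y) x = renormLap G φ u x + renormLap G φ v x := by
  simp only [renormLap, ← Finset.sum_add_distrib]
  exact Finset.sum_congr rfl fun y _ => by ring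

lemma renormLap_const_mul (c : ℝ) (u : V → ℝ) (x : V) :
    renormLap G φ (fun y => c * u y) x = c * renormLap G φ u x := by
  simp only [renormLap, Finset.mul_sum]
  exact Finset.sum_congr rfl fun y _ => by ring

/-- The total weight at `x` is `deg x - λ₀`. -/
lemma sum_weight_le (hM : ∀ v, G.degree v ≤ M) (hφpos : ∀ v, 0 < φ v) (hlam0 : 0 ≤ lam0)
    (hφ : ∀ v, combLap G φ v = lam0 * φ v) (x : V) :
    ∑ y ∈ G.neighborFinset x, φ y / φ x ≤ M := by
  have h := hφ x
  simp only [combLap, Finset.sum_sub_distrib, Finset.sum_const, nsmul_eq_mul,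
    SimpleGraph.card_neighborFinset_eq_degree] at h
  rw [← Finset.sum_div, div_le_iff₀ (hφpos x)]
  have hd : (G.degree x : ℝ) ≤ M := by exact_mod_cast hM x
  nlinarith [mul_nonneg hlam0 (hφpos x).le, mul_le_mul_of_nonneg_right hd (hφpos x).le]

/-- The operator `M - L` has norm at most `M` on bounded functions. -/
lemma abs_mul_sub_renormLap_le (hφpos : ∀ v, 0 < φ v)
    (hW : ∀ x, ∑ y ∈ G.neighborFinset x, φ y / φ x ≤ M)
    {u : V → ℝ} {N : ℝ} (hu : ∀ x, |u x| ≤ N) (x : V) :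
    |M * u x - renormLap G φ u x| ≤ M * N := by
  have hsum : |∑ y ∈ G.neighborFinset x, φ y / φ x * u y|
      ≤ (∑ y ∈ G.neighborFinset x, φ y / φ x) * N := by
    rw [Finset.sum_mul]
    refine (Finset.abs_sum_le_sum_abs _ _).trans (Finset.sum_le_sum fun y _ => ?_)
    have hw : 0 ≤ φ y / φ x := (div_pos (hφpos y) (hφpos x)).le
    rw [abs_mul, abs_of_nonneg hw]
    exact mul_le_mul_of_nonneg_left (hu y) hw
  have hdiag : |(M - ∑ y ∈ G.neighborFinset x, φ y / φ x) * u x|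
      ≤ (M - ∑ y ∈ G.neighborFinset x, φ y / φ x) * N := by
    have hw := sub_nonneg.2 (hW x)
    rw [abs_mul, abs_of_nonneg hw]
    exact mul_le_mul_of_nonneg_left (hu x) hw
  have heq : M * u x - renormLap G φ u x
      = (M - ∑ y ∈ G.neighborFinset x, φ y / φ x) * u x
        + ∑ y ∈ G.neighborFinset x, φ y / φ x * u y := by
    simp only [renormLap, mul_sub, Finset.sum_sub_distrib, sub_mul, Finset.sum_mul]
    ring
  rw [heq]
  linarith [abs_add_le ((M - ∑ y ∈ G.neighborFinset x, φ y / φ x) * u x)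
    (∑ y ∈ G.neighborFinset x, φ y / φ x * u y)]

lemma abs_renormLap_le (hφpos : ∀ v, 0 < φ v)
    (hW : ∀ x, ∑ y ∈ G.neighborFinset x, φ y / φ x ≤ M)
    {u : V → ℝ} {N : ℝ} (hu : ∀ x, |u x| ≤ N) (x : V) :
    |renormLap G φ u x| ≤ 2 * M * N := by
  have h := abs_mul_sub_renormLap_le hφpos hW hu x
  have h' : |M * u x| ≤ M * N := by
    rw [abs_mul, Nat.abs_cast]
    exact mul_le_mul_of_nonneg_left (hu x) M.cast_nonneg
  rw [abs_le] at *
  constructor <;> linarith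

/-- A function on `[0, ∞)` vanishing at `0` with derivative bounded by `C * tⁿ` is bounded by
`C * tⁿ⁺¹ / (n + 1)`. -/
lemma abs_le_of_abs_deriv_le_pow {f f' : ℝ → ℝ} {C : ℝ} {n : ℕ}
    (hf : ContinuousOn f (Set.Ici 0)) (hf' : ∀ t, 0 < t → HasDerivAt f (f' t) t)
    (h0 : f 0 = 0) (hbound : ∀ t, 0 < t → |f' t| ≤ C * t ^ n) {t : ℝ} (ht : 0 ≤ t) :
    |f t| ≤ C * t ^ (n + 1) / (n + 1) := by
  have hn : (n + 1 : ℝ) ≠ 0 := by positivity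
  have hg : ∀ s, HasDerivAt (fun s : ℝ => C * s ^ (n + 1) / (n + 1)) (C * s ^ n) s := fun s => by
    convert! ((hasDerivAt_pow (n + 1) s).const_mul C).div_const (n + 1 : ℝ) using 1
    push_cast
    field_simp
  have hgc : ContinuousOn (fun s : ℝ => C * s ^ (n + 1) / (n + 1)) (Set.Ici 0) :=
    fun s _ => (hg s).continuousAt.continuousWithinAt
  have hsub : MonotoneOn (fun s => C * s ^ (n + 1) / (n + 1) - f s) (Set.Ici 0) := by
    refine monotoneOn_of_hasDerivWithinAt_nonneg (f' := fun s => C * s ^ n - f' s)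
      (convex_Ici 0) (hgc.sub hf) (fun s hs => ?_) fun s hs => ?_ <;> rw [interior_Ici] at hs
    · exact ((hg s).sub (hf' s hs)).hasDerivWithinAt
    · linarith [(abs_le.1 (hbound s hs)).2]
  have hadd : MonotoneOn (fun s => C * s ^ (n + 1) / (n + 1) + f s) (Set.Ici 0) := by
    refine monotoneOn_of_hasDerivWithinAt_nonneg (f' := fun s => C * s ^ n + f' s)
      (convex_Ici 0) (hgc.add hf) (fun s hs => ?_) fun s hs => ?_ <;> rw [interior_Ici] at hs
    · exact ((hg s).add (hf' s hs)).hasDerivWithinAt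
    · linarith [(abs_le.1 (hbound s hs)).1]
  have h1 := hsub (Set.self_mem_Ici) ht ht
  have h2 := hadd (Set.self_mem_Ici) ht ht
  simp only [h0, zero_pow n.succ_ne_zero, mul_zero, zero_div, sub_zero, add_zero] at h1 h2
  exact abs_le.2 ⟨by linarith, by linarith⟩

/-- A bounded solution of the renormalized heat equation with zero initial value vanishes. -/
lemma renormHeat_eq_zero (hφpos : ∀ v, 0 < φ v)
    (hW : ∀ x, ∑ y ∈ G.neighborFinset x, φ y / φ x ≤ M)
    {d : V → ℝ → ℝ} (hc : ∀ x, ContinuousOn (d x) (Set.Ici 0))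
    (hd : ∀ x, ∀ t, 0 < t → HasDerivAt (d x) (-(renormLap G φ (fun y => d y t) x)) t)
    (h0 : ∀ x, d x 0 = 0) {N : ℝ} (hN : ∀ x, ∀ t, 0 ≤ t → |d x t| ≤ N)
    (x : V) {t : ℝ} (ht : 0 ≤ t) : d x t = 0 := by
  have key : ∀ n : ℕ, ∀ x, ∀ t, 0 ≤ t → |d x t| ≤ N * (2 * M) ^ n / n.factorial * t ^ n := by
    intro n
    induction n with
    | zero => simpa using hN
    | succ n ih =>
      intro x t ht
      have h := abs_le_of_abs_deriv_le_pow
        (C := 2 * M * (N * (2 * M) ^ n / n.factorial)) (n := n) (hc x) (hd x) (h0 x)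
        (fun s hs => by
          rw [abs_neg, mul_assoc]
          exact abs_renormLap_le hφpos hW (fun y => ih y s hs.le) x) ht
      refine h.trans_eq ?_
      rw [Nat.factorial_succ]
      push_cast
      field_simp
      ring
  have hlim : Filter.Tendsto (fun n : ℕ => N * ((2 * M * t) ^ n / n.factorial))
      Filter.atTop (nhds (N * 0)) :=
    (FloorSemiring.tendsto_pow_div_factorial_atTop (2 * M * t)).const_mul N
  rw [mul_zero] at hlim
  have : |d x t| ≤ 0 := ge_of_tendsto' hlim fun n => (key n x t ht).trans_eq (by
    rw [mul_pow _ t]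
    ring)
  exact abs_eq_zero.1 (le_antisymm this (abs_nonneg _))

/-- There is a bounded operator on `ℓ^∞(V)` of norm at most `M` acting as `M - L`. -/
lemma exists_shifted_renormLap (hφpos : ∀ v, 0 < φ v)
    (hW : ∀ x, ∑ y ∈ G.neighborFinset x, φ y / φ x ≤ M) :
    ∃ A : lp (fun _ : V => ℝ) ⊤ →L[ℝ] lp (fun _ : V => ℝ) ⊤,
      ‖A‖ ≤ M ∧ ∀ f x, A f x = M * f x - renormLap G φ f x := by
  have hbound : ∀ (f : lp (fun _ : V => ℝ) ⊤) (x : V),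
      |M * f x - renormLap G φ f x| ≤ M * ‖f‖ := fun f =>
    abs_mul_sub_renormLap_le hφpos hW fun y => lp.norm_apply_le_norm ENNReal.top_ne_zero f y
  let A₀ : lp (fun _ : V => ℝ) ⊤ →ₗ[ℝ] lp (fun _ : V => ℝ) ⊤ :=
    { toFun := fun f => ⟨fun x => M * f x - renormLap G φ f x, memℓp_infty
        ⟨M * ‖f‖, by rintro _ ⟨x, rfl⟩; exact hbound f x⟩⟩
      map_add' := fun f g => by
        ext x
        have h := renormLap_add (G := G) (φ := φ) f g x
        change M * (f x + g x) - renormLap G φ (fun y => f y + g y) x =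
          (M * f x - renormLap G φ f x) + (M * g x - renormLap G φ g x)
        rw [h]
        ring
      map_smul' := fun c f => by
        ext x
        have h := renormLap_const_mul (G := G) (φ := φ) c f x
        change M * (c * f x) - renormLap G φ (fun y => c * f y) x =
          c * (M * f x - renormLap G φ f x)
        rw [h]
        ring }
  have hA₀ : ∀ f, ‖A₀ f‖ ≤ M * ‖f‖ := fun f =>
    lp.norm_le_of_forall_le (by positivity) (hbound f)
  exact ⟨A₀.mkContinuous M hA₀, A₀.mkContinuous_norm_le M.cast_nonneg hA₀, fun _ _ => rfl⟩

lemma norm_clm_exp_le {E : Type*} [NormedAddCommGroup E] [NormedSpace ℝ E] [CompleteSpace E]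
    (A : E →L[ℝ] E) : ‖NormedSpace.exp A‖ ≤ Real.exp ‖A‖ := by
  have hA := NormedSpace.exp_series_hasSum_exp' (𝕂 := ℝ) A
  have hr := NormedSpace.exp_series_hasSum_exp' (𝕂 := ℝ) ‖A‖
  rw [← Real.exp_eq_exp_ℝ] at hr
  refine hA.norm_le_of_bounded hr fun n => ?_
  rw [norm_smul, smul_eq_mul, Real.norm_of_nonneg (by positivity)]
  gcongr
  rcases n.eq_zero_or_pos with rfl | hn
  · rw [pow_zero, pow_zero]
    exact ContinuousLinearMap.norm_id_le
  · exact norm_pow_le' A hn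

/-- The solution `e^{-tM} exp(t(M - L)) u₀` of the renormalized heat equation. -/
lemma exists_renormHeat [Nonempty V] (hφpos : ∀ v, 0 < φ v)
    (hW : ∀ x, ∑ y ∈ G.neighborFinset x, φ y / φ x ≤ M)
    {u₀ : V → ℝ} {N₀ : ℝ} (hu₀ : ∀ x, |u₀ x| ≤ N₀) :
    ∃ u : V → ℝ → ℝ,
      (∀ x t, HasDerivAt (u x) (-(renormLap G φ (fun y => u y t) x)) t) ∧
      (∀ x, u x 0 = u₀ x) ∧ ∀ x t, 0 ≤ t → |u x t| ≤ N₀ := by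
  obtain ⟨A, hA, hAapp⟩ := exists_shifted_renormLap hφpos hW
  have hN₀ : 0 ≤ N₀ := (abs_nonneg _).trans (hu₀ (Classical.arbitrary V))
  let f₀ : lp (fun _ : V => ℝ) ⊤ :=
    ⟨u₀, memℓp_infty ⟨N₀, by rintro _ ⟨x, rfl⟩; exact hu₀ x⟩⟩
  have hf₀ : ‖f₀‖ ≤ N₀ := lp.norm_le_of_forall_le hN₀ hu₀
  let F : ℝ → lp (fun _ : V => ℝ) ⊤ := fun t => NormedSpace.exp (t • A) f₀
  have hF : ∀ t, HasDerivAt F (A (F t)) t := fun t => by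
    simpa using (hasDerivAt_exp_smul_const' A t).clm_apply (hasDerivAt_const t f₀)
  have hFx : ∀ x t, HasDerivAt (fun s => F s x) (A (F t) x) t := fun x t =>
    (lp.evalCLM ℝ (fun _ : V => ℝ) ⊤ x).hasFDerivAt.comp_hasDerivAt t (hF t)
  refine ⟨fun x t => Real.exp (-(M * t)) * F t x, fun x t => ?_, fun x => ?_, fun x t ht => ?_⟩
  · have hexp : HasDerivAt (fun s : ℝ => Real.exp (-(M * s))) (Real.exp (-(M * t)) * -(M * 1)) t :=
      ((hasDerivAt_id t).const_mul (M : ℝ)).neg.exp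
    convert! hexp.mul (hFx x t) using 1
    rw [renormLap_const_mul, hAapp]
    ring
  · have hF0 : F 0 = f₀ := by
      change NormedSpace.exp ((0 : ℝ) • A) f₀ = f₀
      have hz : (0 : ℝ) • A = 0 := zero_smul ℝ A
      rw [hz, NormedSpace.exp_zero, one_apply_eq_self]
    simp [hF0, f₀]
  · have hnorm : ‖F t‖ ≤ Real.exp (M * t) * N₀ := by
      refine ((NormedSpace.exp (t • A)).le_opNorm f₀).trans ?_
      gcongr
      refine (norm_clm_exp_le (t • A)).trans (Real.exp_le_exp.2 ?_)
      rw [norm_smul, Real.norm_of_nonneg ht, mul_comm]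
      gcongr
    have hx : |F t x| ≤ Real.exp (M * t) * N₀ :=
      (lp.norm_apply_le_norm ENNReal.top_ne_zero (F t) x).trans hnorm
    rw [abs_mul, Real.abs_exp]
    calc Real.exp (-(M * t)) * |F t x|
        ≤ Real.exp (-(M * t)) * (Real.exp (M * t) * N₀) := by gcongr
      _ = N₀ := by rw [← mul_assoc, ← Real.exp_add, neg_add_cancel, Real.exp_zero, one_mul]

end RenormalizedHeat

/-- Existence and uniqueness of bounded solutions of the renormalized heat equation
`Lu + ∂u/∂t = 0`, `u(·,0) = u₀`, on an infinite connected graph of bounded valence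
with positive ground state `φ`, `Δφ = λ₀φ`. The solution satisfies `|u| ≤ N₀`
whenever `|u₀| ≤ N₀`. -/
theorem renormalized_heat_equation_existence_uniqueness {V : Type*} [Infinite V]
    (G : SimpleGraph V) [G.LocallyFinite] (hconn : G.Connected)
    (M : ℕ) (hM : ∀ v, G.degree v ≤ M)
    (φ : V → ℝ) (hφpos : ∀ v, 0 < φ v) (lam0 : ℝ) (hlam0 : 0 ≤ lam0)
    (hφ : ∀ v, combLap G φ v = lam0 * φ v)
    (u₀ : V → ℝ) (N₀ : ℝ) (hu₀ : ∀ x, |u₀ x| ≤ N₀) :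
    ∃ u : V → ℝ → ℝ,
      ((∀ x, ContinuousOn (u x) (Set.Ici 0)) ∧
        (∀ x, ∀ t, 0 < t →
          HasDerivAt (u x) (-(renormLap G φ (fun y => u y t) x)) t) ∧
        (∀ x, u x 0 = u₀ x) ∧
        (∃ N : ℝ, ∀ x, ∀ t, 0 ≤ t → |u x t| ≤ N)) ∧
      (∀ x, ∀ t, 0 ≤ t → |u x t| ≤ N₀) ∧
      (∀ v : V → ℝ → ℝ,
        ((∀ x, ContinuousOn (v x) (Set.Ici 0)) ∧
          (∀ x, ∀ t, 0 < t →
            HasDerivAt (v x) (-(renormLap G φ (fun y => v y t) x)) t) ∧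
          (∀ x, v x 0 = u₀ x) ∧
          (∃ N : ℝ, ∀ x, ∀ t, 0 ≤ t → |v x t| ≤ N)) →
        ∀ x, ∀ t, 0 ≤ t → v x t = u x t) := by
  have hW := sum_weight_le hM hφpos hlam0 hφ
  obtain ⟨u, hderiv, h0, hbound⟩ := exists_renormHeat hφpos hW hu₀
  have hcont : ∀ x, ContinuousOn (u x) (Set.Ici 0) :=
    fun x t _ => (hderiv x t).continuousAt.continuousWithinAt
  refine ⟨u, ⟨hcont, fun x t _ => hderiv x t, h0, N₀, hbound⟩, hbound, ?_⟩
  rintro v ⟨hvc, hvd, hv0, N, hvN⟩ x t ht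
  refine sub_eq_zero.1 (renormHeat_eq_zero (d := fun x t => v x t - u x t) (N := N + N₀)
    hφpos hW (fun x => (hvc x).sub (hcont x)) (fun x t ht => ?_) (fun x => ?_)
    (fun x t ht => ?_) x ht)
  · convert! (hvd x t ht).sub (hderiv x t) using 1
    rw [renormLap_sub]
    ring
  · simp [hv0, h0]
  · exact (abs_sub _ _).trans (add_le_add (hvN x t ht) (hbound x t ht))
end
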